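/- For each ζ with 0 ≤ ζ < 4β - 2α and each s ∈ (E1, E2), the boundary value of g from the upper half-plane equals g₊(ζ, s) = i (2s - 2β + ζ) √((s - E1)(E2 - s)), and its imaginary part is strictly negative: Im g₊(ζ, s) = (2s - 2β + ζ) √((s - E1)(E2 - s)) < 0. -/

import Mathlib

open Complex Filter Set Topology

/-- The branch `X(k) = (k - E1)^{1/2} (k - E2)^{1/2}` with principal square roots. -/
noncomputable def Xfun (E1 E2 : ℝ) (k : ℂ) : ℂ :=
  (k - (E1 : ℂ)) ^ ((1 : ℂ) / 2) * (k - (E2 : ℂ)) ^ ((1 : ℂ) / 2)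

/-- The `g`-function `g(ζ, k) = (2k - 2β + ζ) X(k)`. -/
noncomputable def gfun (E1 E2 β ζ : ℝ) (k : ℂ) : ℂ :=
  (2 * k - 2 * (β : ℂ) + (ζ : ℂ)) * Xfun E1 E2 k

/-- On the closed upper half-plane the principal power is continuous at negative reals. -/
theorem continuousWithinAt_cpow_const_of_re_neg_of_im_zero {z : ℂ} (hre : z.re < 0)
    (him : z.im = 0) (w : ℂ) :
    ContinuousWithinAt (fun x : ℂ => x ^ w) {x : ℂ | 0 ≤ x.im} z := by
  have hz : z ≠ 0 := fun h => by simp [h] at hre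
  have hexp : ContinuousWithinAt (fun x : ℂ => exp (log x * w)) {x : ℂ | 0 ≤ x.im} z :=
    ((continuousWithinAt_log_of_re_neg_of_im_zero hre him).mul_const w).cexp
  refine hexp.congr_of_eventuallyEq ?_ (cpow_def_of_ne_zero hz w)
  filter_upwards [mem_nhdsWithin_of_mem_nhds (isOpen_ne.mem_nhds hz)] with x hx
  exact cpow_def_of_ne_zero hx w

theorem ofReal_cpow_half_of_nonneg {x : ℝ} (hx : 0 ≤ x) :
    (x : ℂ) ^ ((1 : ℂ) / 2) = (Real.sqrt x : ℂ) := by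
  rw [Real.sqrt_eq_rpow, ofReal_cpow hx]
  norm_num

theorem ofReal_cpow_half_of_nonpos {x : ℝ} (hx : x ≤ 0) :
    (x : ℂ) ^ ((1 : ℂ) / 2) = I * (Real.sqrt (-x) : ℂ) := by
  have hI : exp (Real.pi * I * (1 / 2)) = I := by
    rw [show (Real.pi : ℂ) * I * (1 / 2) = Real.pi / 2 * I by ring, exp_pi_div_two_mul_I]
  rw [ofReal_cpow_of_nonpos hx, hI, ← ofReal_neg,
    ofReal_cpow_half_of_nonneg (neg_nonneg.mpr hx), mul_comm]

/-- The boundary value of `X` on the cut `(E1, E2)`, taken from the upper half-plane. -/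
theorem tendsto_Xfun_upper {E1 E2 s : ℝ} (hs : s ∈ Set.Ioo E1 E2) :
    Tendsto (fun ε : ℝ => Xfun E1 E2 ((s : ℂ) + (ε : ℂ) * I)) (𝓝[>] (0 : ℝ))
      (𝓝 (I * (Real.sqrt ((s - E1) * (E2 - s)) : ℂ))) := by
  have hpos : 0 < s - E1 := sub_pos.mpr hs.1
  have hneg : s - E2 < 0 := sub_neg.mpr hs.2
  have hline (E : ℝ) : Tendsto (fun ε : ℝ => (s : ℂ) + (ε : ℂ) * I - (E : ℂ)) (𝓝[>] (0 : ℝ))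
      (𝓝 ((s - E : ℝ) : ℂ)) := by
    have hcont : Continuous fun ε : ℝ => (s : ℂ) + (ε : ℂ) * I - (E : ℂ) := by fun_prop
    simpa using (hcont.tendsto 0).mono_left nhdsWithin_le_nhds
  have hleft := ((continuousAt_cpow_const (b := (1 : ℂ) / 2)
    (ofReal_mem_slitPlane.mpr hpos)).tendsto).comp (hline E1)
  have hright := (continuousWithinAt_cpow_const_of_re_neg_of_im_zero
    (z := ((s - E2 : ℝ) : ℂ)) (by simpa using hneg) (ofReal_im _) ((1 : ℂ) / 2)).tendsto.comp
    (tendsto_nhdsWithin_iff.mpr ⟨hline E2, by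
      filter_upwards [self_mem_nhdsWithin] with ε hε
      simpa using (mem_Ioi.mp hε).le⟩)
  convert hleft.mul hright using 2
  · rfl
  · rw [ofReal_cpow_half_of_nonneg hpos.le, ofReal_cpow_half_of_nonpos hneg.le, neg_sub,
      Real.sqrt_mul hpos.le, ofReal_mul]
    ring

theorem stmt11 (α β : ℝ) (hα : 0 < α) (hαβ : α < 2 * β)
    (E1 E2 : ℝ) (hE1 : E1 = -β - α) (hE2 : E2 = -β + α)
    (ζ : ℝ) (hζ : 0 ≤ ζ) (hζ' : ζ < 4 * β - 2 * α) :
    ∀ s ∈ Set.Ioo E1 E2,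
      Tendsto (fun ε : ℝ => gfun E1 E2 β ζ ((s : ℂ) + (ε : ℂ) * I)) (𝓝[>] (0 : ℝ))
        (𝓝 (I * ((2 * s - 2 * β + ζ : ℝ) : ℂ) * (Real.sqrt ((s - E1) * (E2 - s)) : ℂ))) ∧
      (I * ((2 * s - 2 * β + ζ : ℝ) : ℂ) * (Real.sqrt ((s - E1) * (E2 - s)) : ℂ)).im
        = (2 * s - 2 * β + ζ) * Real.sqrt ((s - E1) * (E2 - s)) ∧
      (2 * s - 2 * β + ζ) * Real.sqrt ((s - E1) * (E2 - s)) < 0 := by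
  intro s hs
  have hfactor : 2 * s - 2 * β + ζ < 0 := by linarith [hs.2]
  have hsqrt : 0 < Real.sqrt ((s - E1) * (E2 - s)) :=
    Real.sqrt_pos.mpr (mul_pos (sub_pos.mpr hs.1) (sub_pos.mpr hs.2))
  refine ⟨?_, ?_, mul_neg_of_neg_of_pos hfactor hsqrt⟩
  · have hcont : Continuous fun ε : ℝ =>
        2 * ((s : ℂ) + (ε : ℂ) * I) - 2 * (β : ℂ) + (ζ : ℂ) := by fun_prop
    have hlinear := (hcont.tendsto 0).mono_left (nhdsWithin_le_nhds (s := Set.Ioi (0 : ℝ)))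
    convert hlinear.mul (tendsto_Xfun_upper hs) using 2
    · rfl
    · push_cast
      ring
  · rw [mul_assoc, ← ofReal_mul, I_mul_im, ofReal_re]
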